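/- Let I be a monomial ideal in K[x_1,...,x_n] with linear quotients with respect to an ordering m_1,...,m_k of its minimal generators, and let set(m_j) denote the set of variables generating (m_1,...,m_{j-1}) : m_j. Then for each ℓ ≥ 1, the ℓ-th Betti number of I equals the sum over j from 1 to k of binomial(|set(m_j)|, ℓ-1). In particular, for I = (x_1 y_2 z_3, x_1 y_2 z_4, x_3 y_1 z_4, x_3 y_2 z_4) with the given order, β_0(I) = 4 and β_1(I) = 3. -/

import Mathlib

open MvPolynomial

/-- Minimal number of generators of a module. -/
noncomputable def nuMod (R : Type) [CommRing R] (M : Type) [AddCommGroup M] [Module R M] : ℕ :=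
  sInf {c | ∃ s : Finset M, s.card = c ∧ Submodule.span R (s : Set M) = ⊤}

/-- `HasBetti R ℓ M b`: an iterated minimal-cover chain starting from `M` (at each step a
surjection onto the current module from a free module whose rank is the minimal number of
generators, followed by passing to its kernel, the syzygy module) reaches after `ℓ` steps
a module whose minimal number of generators is `b`; i.e. in a minimal free resolution
`… → F_1 → F_0 → M → 0` the rank of `F_ℓ` is `b` (`HasBetti R 0 M b` says `M` is
minimally generated by `b` elements). -/
def HasBetti (R : Type) [CommRing R] :
    ℕ → (M : Type) → [AddCommGroup M] → [Module R M] → ℕ → Prop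
  | 0, M, _, _, b => b = nuMod R M
  | (ℓ + 1), M, _, _, b =>
      ∃ f : (Fin (nuMod R M) → R) →ₗ[R] M, Function.Surjective f ∧
        HasBetti R ℓ (LinearMap.ker f) b

/-- The ring `K[x_1,…,x_4, y_1,…,y_4, z_1,…,z_4]` of the concrete example. -/
abbrev PR (K : Type) [Field K] := MvPolynomial (Fin 3 × Fin 4) K

noncomputable def xv (K : Type) [Field K] (i : Fin 4) : PR K := X (0, i)
noncomputable def yv (K : Type) [Field K] (i : Fin 4) : PR K := X (1, i)
noncomputable def zv (K : Type) [Field K] (i : Fin 4) : PR K := X (2, i)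

/-- A length `ℓ` piece of a minimal free resolution of a submodule of a free module,
with the linear part of every differential injective modulo `m`. -/
def LinRes {R : Type} [CommRing R] (m : Ideal R) :
    ℕ → (ι : Type) → Submodule R (ι → R) → (ℕ → ℕ) → Prop
  | 0, _, _, _ => True
  | (ℓ + 1), ι, M, b =>
      ∃ (κ : Type) (_ : Fintype κ) (f : (κ → R) →ₗ[R] (ι → R)),
        Fintype.card κ = b 0 ∧ LinearMap.range f = M ∧
        (∀ x, (∀ i, f x i ∈ m ^ 2) → ∀ k, x k ∈ m) ∧
        LinRes m ℓ κ (LinearMap.ker f) (fun i => b (i + 1))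

theorem LinRes.bot {R : Type} [CommRing R] (m : Ideal R) (ℓ : ℕ) (ι : Type)
    (M : Submodule R (ι → R)) (hM : M = ⊥) : LinRes m ℓ ι M (fun _ => 0) := by
  induction ℓ generalizing ι with
  | zero => trivial
  | succ ℓ ih =>
    refine ⟨Fin 0, inferInstance, 0, by simp, by simp [hM], fun _ _ k => k.elim0, ?_⟩
    exact ih _ _ (Subsingleton.elim _ _)

theorem LinRes.horseshoe {R : Type} [CommRing R] (m : Ideal R) (ℓ : ℕ) :
    ∀ (ι ι' κ : Type) (A : Submodule R (ι → R)) (B : Submodule R (κ → R))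
    (C : Submodule R (ι' → R)) (a c : ℕ → ℕ)
    (i : (ι → R) →ₗ[R] (κ → R)) (p : (κ → R) →ₗ[R] (ι' → R))
    (_ : ∀ x ∈ B, ∀ j, x j ∈ m)
    (_ : Function.Injective i)
    (_ : ∀ x, (∀ j, i x j ∈ m ^ 2) → ∀ j, x j ∈ m ^ 2)
    (_ : ∀ x, (∀ j, x j ∈ m ^ 2) → ∀ j, p x j ∈ m ^ 2)
    (_ : ∀ x, p (i x) = 0)
    (_ : ∀ x ∈ A, i x ∈ B)
    (_ : ∀ x ∈ B, p x ∈ C)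
    (_ : ∀ x ∈ B, p x = 0 → ∃ y ∈ A, i y = x)
    (_ : ∀ x ∈ C, ∃ y ∈ B, p y = x)
    (_ : LinRes m ℓ ι A a) (_ : LinRes m ℓ ι' C c),
    LinRes m ℓ κ B (fun n => a n + c n) := by
  induction ℓ with
  | zero => intros; trivial
  | succ ℓ ih =>
    intro ι ι' κ A B C a c i p hB hinj him hpm hpi hA hC hex hsurj resA resC
    obtain ⟨κ₁, _, fA, cardA, rangeA, minA, resA⟩ := resA
    obtain ⟨κ₂, _, fC, cardC, rangeC, minC, resC⟩ := resC
    classical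
    have hfA : ∀ x, fA x ∈ A := fun x => rangeA ▸ LinearMap.mem_range_self fA x
    have hfC : ∀ x, fC x ∈ C := fun x => rangeC ▸ LinearMap.mem_range_self fC x
    choose v hvB hvp using fun k : κ₂ => hsurj _ (hfC (Pi.single k 1))
    let g : (κ₂ → R) →ₗ[R] (κ → R) := Fintype.linearCombination R v
    have hg : ∀ y, g y = ∑ k, y k • v k := fun y => Fintype.linearCombination_apply R v y
    have hgB : ∀ y, g y ∈ B := by
      intro y; rw [hg]
      exact Submodule.sum_mem _ fun k _ => B.smul_mem _ (hvB k)
    have hpg : ∀ y, p (g y) = fC y := by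
      intro y
      have : p ∘ₗ g = fC := by
        refine LinearMap.pi_ext' fun k => LinearMap.ext_ring ?_
        simp [g, hvp]
      rw [← this]; rfl
    have hgm : ∀ y, (∀ k, y k ∈ m) → ∀ j, g y j ∈ m ^ 2 := by
      intro y hy j
      rw [hg, Finset.sum_apply]
      refine Ideal.sum_mem _ fun k _ => ?_
      rw [pow_two]
      exact Ideal.mul_mem_mul (hy k) (hB _ (hvB k) j)
    let fB : (κ₁ ⊕ κ₂ → R) →ₗ[R] (κ → R) :=
      i ∘ₗ fA ∘ₗ LinearMap.funLeft R R Sum.inl + g ∘ₗ LinearMap.funLeft R R Sum.inr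
    have hfB : ∀ z, fB z = i (fA (z ∘ Sum.inl)) + g (z ∘ Sum.inr) := fun z => rfl
    have hpf : ∀ z, p (fB z) = fC (z ∘ Sum.inr) := by
      intro z; rw [hfB, map_add, hpi, hpg, zero_add]
    have minB : ∀ x, (∀ i, fB x i ∈ m ^ 2) → ∀ k, x k ∈ m := by
      intro z hz
      have h1 : ∀ k, (z ∘ Sum.inr) k ∈ m := by
        apply minC
        rw [← hpf]
        exact hpm _ hz
      have h2 : ∀ k, (z ∘ Sum.inl) k ∈ m := by
        apply minA
        apply him
        intro j
        have := Ideal.sub_mem _ (hz j) (hgm _ h1 j)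
        rw [hfB] at this
        simpa using this
      rintro (k | k)
      · exact h2 k
      · exact h1 k
    refine ⟨κ₁ ⊕ κ₂, inferInstance, fB, by simp [cardA, cardC], ?_, minB, ?_⟩
    · apply le_antisymm
      · rintro _ ⟨z, rfl⟩
        rw [hfB]
        exact B.add_mem (hA _ (hfA _)) (hgB _)
      · intro x hx
        obtain ⟨y, hy⟩ : p x ∈ LinearMap.range fC := rangeC ▸ hC x hx
        obtain ⟨w, hw, hw'⟩ := hex (x - g y) (B.sub_mem hx (hgB y))
          (by rw [map_sub, hpg, hy, sub_self])
        obtain ⟨u, rfl⟩ : w ∈ LinearMap.range fA := rangeA ▸ hw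
        refine ⟨Sum.elim u y, ?_⟩
        rw [hfB]
        simp [hw']
    · let i' : (κ₁ → R) →ₗ[R] (κ₁ ⊕ κ₂ → R) :=
        { toFun := fun x => Sum.elim x 0
          map_add' := by intro x y; ext (k | k) <;> simp
          map_smul' := by intro x y; ext (k | k) <;> simp }
      have hi' : ∀ x, i' x = Sum.elim x 0 := fun _ => rfl
      refine ih κ₁ κ₂ (κ₁ ⊕ κ₂) (LinearMap.ker fA) (LinearMap.ker fB) (LinearMap.ker fC) _ _
        i' (LinearMap.funLeft R R Sum.inr) ?_ ?_ ?_ ?_ ?_ ?_ ?_ ?_ ?_ resA resC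
      · intro x hx
        apply minB
        rw [LinearMap.mem_ker.1 hx]
        simp
      · intro x y h
        ext k
        exact congrFun h (Sum.inl k)
      · intro x h k
        exact h (Sum.inl k)
      · intro x h k
        exact h (Sum.inr k)
      · intro x; ext k; rfl
      · intro x hx
        rw [LinearMap.mem_ker] at hx ⊢
        rw [hfB, hi']
        simp [hx]
      · intro x hx
        rw [LinearMap.mem_ker] at hx ⊢
        have := hpf x
        rw [hx, map_zero] at this
        exact this.symm
      · intro x hx h0
        rw [LinearMap.mem_ker] at hx
        have h0' : x ∘ Sum.inr = 0 := h0
        rw [hfB, h0', map_zero, add_zero] at hx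
        refine ⟨x ∘ Sum.inl, ?_, ?_⟩
        · rw [LinearMap.mem_ker]
          apply hinj
          rw [hx, map_zero]
        · ext (k | k)
          · rfl
          · exact (congrFun h0' k).symm
      · intro y hy
        rw [LinearMap.mem_ker] at hy
        obtain ⟨w, hw, hw'⟩ := hex (g y) (hgB y) (by rw [hpg, hy])
        obtain ⟨u, rfl⟩ : w ∈ LinearMap.range fA := rangeA ▸ hw
        refine ⟨Sum.elim (-u) y, ?_, rfl⟩
        rw [LinearMap.mem_ker, hfB]
        simp [hw']

/-- Syzygies of a sequence whose successive colon ideals are resolved. -/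
theorem LinRes.syz {R : Type} [CommRing R] (m : Ideal R) (ℓ : ℕ) :
    ∀ (k : ℕ) (u : Fin k → R)
    (_ : ∀ x : Fin k → R, ∑ i, x i * u i = 0 → ∀ i, x i ∈ m)
    (C : Fin k → Submodule R (Unit → R)) (b : Fin k → ℕ → ℕ)
    (_ : ∀ j c, c ∈ C j ↔ c () * u j ∈ Ideal.span (u '' {i | i < j}))
    (_ : ∀ j, LinRes m ℓ Unit (C j) (b j)),
    LinRes m ℓ (Fin k) (LinearMap.ker (Fintype.linearCombination R u))
      (fun n => ∑ j, b j n) := by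
  intro k
  induction k with
  | zero =>
    intro u _ C b _ _
    simpa using LinRes.bot m ℓ (Fin 0) _ (Subsingleton.elim _ _)
  | succ k ih =>
    intro u hmin C b hC res
    have himg : ∀ j : Fin k, u '' {i | i < j.castSucc} = (u ∘ Fin.castSucc) '' {i | i < j} := by
      intro j
      ext r
      constructor
      · rintro ⟨i, hi, rfl⟩
        have hi' : i.val < j.val := hi
        exact ⟨⟨i.val, by omega⟩, hi', rfl⟩
      · rintro ⟨i, hi, rfl⟩
        exact ⟨i.castSucc, hi, rfl⟩
    have himl : u '' {i | i < Fin.last k} = Set.range (u ∘ Fin.castSucc) := by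
      ext r
      constructor
      · rintro ⟨i, hi, rfl⟩
        exact ⟨⟨i.val, hi⟩, rfl⟩
      · rintro ⟨i, rfl⟩
        exact ⟨i.castSucc, Fin.castSucc_lt_last i, rfl⟩
    have hmin' : ∀ x : Fin k → R, ∑ i, x i * (u ∘ Fin.castSucc) i = 0 → ∀ i, x i ∈ m := by
      intro x hx i
      have := hmin (Fin.snoc x 0) (by rw [Fin.sum_univ_castSucc]; simpa using hx) i.castSucc
      simpa using this
    have hk := ih (u ∘ Fin.castSucc) hmin' (fun j => C j.castSucc) (fun j => b j.castSucc)
      (fun j c => by rw [hC, himg]; rfl) (fun j => res _)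
    simp only [Fin.sum_univ_castSucc]
    let i' : (Fin k → R) →ₗ[R] (Fin (k + 1) → R) :=
      { toFun := fun x => Fin.snoc x 0
        map_add' := by
          intro x y; ext j; refine Fin.lastCases ?_ (fun j => ?_) j <;> simp
        map_smul' := by
          intro x y; ext j; refine Fin.lastCases ?_ (fun j => ?_) j <;> simp }
    have hi' : ∀ x, i' x = Fin.snoc (α := fun _ => R) x 0 := fun _ => rfl
    have hker : ∀ (n : ℕ) (w : Fin n → R) (x : Fin n → R),
        x ∈ LinearMap.ker (Fintype.linearCombination R w) ↔ ∑ j, x j * w j = 0 := by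
      intro n w x
      rw [LinearMap.mem_ker, Fintype.linearCombination_apply]; rfl
    refine LinRes.horseshoe m ℓ (Fin k) Unit (Fin (k + 1)) _ _ (C (Fin.last k)) _ _ i'
      (LinearMap.funLeft R R (fun _ => Fin.last k)) ?_ ?_ ?_ ?_ ?_ ?_ ?_ ?_ ?_ hk (res _)
    · intro x hx
      exact hmin x ((hker _ _ _).1 hx)
    · intro x y h
      ext j
      have := congrFun h j.castSucc
      simpa [hi'] using this
    · intro x h j
      have := h j.castSucc
      simpa [hi'] using this
    · intro x h j
      exact h _
    · intro x
      ext j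
      simp [hi', LinearMap.funLeft_apply]
    · intro x hx
      rw [hker] at hx ⊢
      rw [Fin.sum_univ_castSucc, hi']
      simpa using hx
    · intro x hx
      rw [hker, Fin.sum_univ_castSucc] at hx
      rw [hC, himl, Ideal.mem_span_range_iff_exists_fun]
      refine ⟨fun j => - x j.castSucc, ?_⟩
      simp only [neg_mul, Finset.sum_neg_distrib, LinearMap.funLeft_apply, Function.comp_apply]
      linear_combination -hx
    · intro x hx h0
      have h0' : x (Fin.last k) = 0 := congrFun h0 ()
      rw [hker, Fin.sum_univ_castSucc, h0', zero_mul, add_zero] at hx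
      refine ⟨fun j => x j.castSucc, (hker _ _ _).2 hx, ?_⟩
      ext j
      rw [hi']
      refine Fin.lastCases ?_ (fun j => ?_) j <;> simp [h0']
    · intro c hc
      rw [hC, himl, Ideal.mem_span_range_iff_exists_fun] at hc
      obtain ⟨r, hr⟩ := hc
      refine ⟨Fin.snoc (α := fun _ => R) (fun j => - r j) (c ()), ?_, ?_⟩
      · rw [hker, Fin.sum_univ_castSucc]
        simp only [Fin.snoc_castSucc, Fin.snoc_last, neg_mul, Finset.sum_neg_distrib]
        simp only [Function.comp_apply] at hr
        rw [hr]; ring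
      · ext j
        simp [LinearMap.funLeft_apply]

theorem nuMod_eq_card {R : Type} [CommRing R] (m : Ideal R) (hm : m ≠ ⊤)
    {M : Type} [AddCommGroup M] [Module R M] {κ : Type} [Fintype κ]
    (f : (κ → R) →ₗ[R] M) (hf : Function.Surjective f)
    (hker : ∀ x, f x = 0 → ∀ k, x k ∈ m) : nuMod R M = Fintype.card κ := by
  classical
  have hgen : Submodule.span R
      ((Finset.univ.image fun k => f (Pi.single k 1) : Finset M) : Set M) = ⊤ := by
    rw [eq_top_iff]
    rintro x -
    obtain ⟨y, rfl⟩ := hf x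
    rw [LinearMap.pi_apply_eq_sum_univ f y]
    refine Submodule.sum_mem _ fun k _ => Submodule.smul_mem _ _ (Submodule.subset_span ?_)
    simp only [Finset.coe_image, Finset.coe_univ, Set.image_univ, Set.mem_range]
    refine ⟨k, congrArg f ?_⟩
    ext j
    simp [Pi.single_apply, eq_comm]
  have hmem : (Finset.univ.image fun k => f (Pi.single k 1) : Finset M).card ∈
      {c | ∃ s : Finset M, s.card = c ∧ Submodule.span R (s : Set M) = ⊤} := ⟨_, rfl, hgen⟩
  unfold nuMod
  apply le_antisymm
  · exact (Nat.sInf_le hmem).trans Finset.card_image_le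
  · refine le_csInf ⟨_, hmem⟩ ?_
    rintro c ⟨s, rfl, hs⟩
    have : Nontrivial (R ⧸ m) := Ideal.Quotient.nontrivial_iff.2 hm
    choose v hv using fun t : s => hf t.1
    let φ : (s → R ⧸ m) →ₗ[R ⧸ m] (κ → R ⧸ m) :=
      Fintype.linearCombination (R ⧸ m) (fun t k => Ideal.Quotient.mk m (v t k))
    have hφ : Function.Surjective φ := by
      intro y
      choose z hz using fun k => Ideal.Quotient.mk_surjective (I := m) (y k)
      have h1 : f z ∈ Submodule.span R (Set.range ((↑) : s → M)) := by
        have : Set.range ((↑) : s → M) = (s : Set M) := by simp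
        rw [this, hs]; trivial
      rw [Submodule.mem_span_range_iff_exists_fun] at h1
      obtain ⟨r, hr⟩ := h1
      refine ⟨fun t => Ideal.Quotient.mk m (r t), ?_⟩
      have h2 : f (∑ t, r t • v t - z) = 0 := by
        rw [map_sub, map_sum, ← hr, sub_eq_zero]
        simp [hv]
      ext k
      have h3 := hker _ h2 k
      rw [Pi.sub_apply, ← Ideal.Quotient.mk_eq_mk_iff_sub_mem, hz] at h3
      rw [← h3]
      simp [φ, Fintype.linearCombination_apply, Finset.sum_apply]
    simpa using card_le_of_surjective (R ⧸ m) φ hφ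

theorem nuMod_equiv {R : Type} [CommRing R]
    {M M' : Type} [AddCommGroup M] [Module R M] [AddCommGroup M'] [Module R M']
    (e : M ≃ₗ[R] M') : nuMod R M = nuMod R M' := by
  classical
  have key : ∀ {M M' : Type} [AddCommGroup M] [Module R M] [AddCommGroup M'] [Module R M']
      (e : M ≃ₗ[R] M') (c : ℕ), (∃ s : Finset M, s.card = c ∧ Submodule.span R (s : Set M) = ⊤) →
      (∃ s : Finset M', s.card = c ∧ Submodule.span R (s : Set M') = ⊤) := by
    rintro M M' _ _ _ _ e c ⟨s, hs, hs'⟩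
    refine ⟨s.map e.toEquiv.toEmbedding, by simpa using hs, ?_⟩
    have : ((s.map e.toEquiv.toEmbedding : Finset M') : Set M') = e.toLinearMap '' (s : Set M) := by
      simp
    rw [this, Submodule.span_image, hs', Submodule.map_top, LinearEquiv.range]
  unfold nuMod
  congr 1
  ext c
  exact ⟨key e c, key e.symm c⟩

theorem HasBetti.succ {R : Type} [CommRing R] {ℓ : ℕ}
    {M : Type} [AddCommGroup M] [Module R M] {n b : ℕ} (hn : n = nuMod R M)
    (f : (Fin n → R) →ₗ[R] M) (hf : Function.Surjective f)
    (h : HasBetti R ℓ (LinearMap.ker f) b) : HasBetti R (ℓ + 1) M b := by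
  subst hn
  exact ⟨f, hf, h⟩

theorem HasBetti.equiv {R : Type} [CommRing R] {ℓ : ℕ}
    {M M' : Type} [AddCommGroup M] [Module R M] [AddCommGroup M'] [Module R M']
    (e : M ≃ₗ[R] M') {b : ℕ} (h : HasBetti R ℓ M b) : HasBetti R ℓ M' b := by
  cases ℓ with
  | zero =>
    have h' : b = nuMod R M := h
    exact h'.trans (nuMod_equiv e)
  | succ ℓ =>
    obtain ⟨f, hf, hb⟩ := h
    refine HasBetti.succ (nuMod_equiv e) (e.toLinearMap ∘ₗ f) (e.surjective.comp hf) ?_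
    rwa [LinearEquiv.ker_comp]

theorem LinRes.hasBetti {R : Type} [CommRing R] (m : Ideal R) (hm : m ≠ ⊤) (ℓ : ℕ) :
    ∀ {M : Type} [AddCommGroup M] [Module R M] {κ : Type} [Fintype κ]
    (f : (κ → R) →ₗ[R] M) (_ : Function.Surjective f)
    (_ : ∀ x, f x = 0 → ∀ k, x k ∈ m) (b : ℕ → ℕ) (_ : Fintype.card κ = b 0)
    (_ : LinRes m ℓ κ (LinearMap.ker f) (fun i => b (i + 1))), HasBetti R ℓ M (b ℓ) := by
  induction ℓ with
  | zero =>
    intro M _ _ κ _ f hf hker b hb _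
    exact hb.symm.trans (nuMod_eq_card m hm f hf hker).symm
  | succ ℓ ih =>
    intro M _ _ κ _ f hf hker b hb res
    obtain ⟨κ', _, g, hcard, hrange, hmin, hres⟩ := res
    have hgk : ∀ x, g x ∈ LinearMap.ker f := fun x => hrange ▸ LinearMap.mem_range_self g x
    have h1 : HasBetti R ℓ (LinearMap.ker f) (b (ℓ + 1)) := by
      refine ih (g.codRestrict _ hgk) ?_ ?_ (fun i => b (i + 1)) hcard ?_
      · rintro ⟨y, hy⟩
        rw [← hrange] at hy
        obtain ⟨x, rfl⟩ := hy
        exact ⟨x, rfl⟩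
      · intro x hx
        apply hmin
        have : g x = 0 := congrArg Subtype.val hx
        rw [this]; simp
      · rwa [LinearMap.ker_codRestrict]
    let e : (Fin (Fintype.card κ) → R) ≃ₗ[R] (κ → R) :=
      LinearEquiv.funCongrLeft R R (Fintype.equivFin κ)
    refine HasBetti.succ (nuMod_eq_card m hm f hf hker).symm (f ∘ₗ e.toLinearMap)
      (hf.comp e.surjective) ?_
    refine HasBetti.equiv (LinearEquiv.symm ?_) h1
    exact e.ofSubmodules _ _ (by
      rw [LinearMap.ker_comp]
      exact Submodule.map_comap_eq_of_surjective e.surjective _)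

section Poly
variable {K : Type} [Field K] {σ : Type}

/-- The irrelevant maximal ideal. -/
noncomputable def irr (K σ : Type) [Field K] : Ideal (MvPolynomial σ K) :=
  RingHom.ker (constantCoeff : MvPolynomial σ K →+* K)

theorem mem_irr {p : MvPolynomial σ K} : p ∈ irr K σ ↔ constantCoeff p = 0 := Iff.rfl

theorem irr_ne_top : irr K σ ≠ ⊤ := RingHom.ker_ne_top _

theorem pderiv_irr_sq {p : MvPolynomial σ K} (hp : p ∈ irr K σ ^ 2) (s : σ) :
    constantCoeff (pderiv s p) = 0 := by
  rw [pow_two] at hp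
  refine Submodule.mul_induction_on hp ?_ ?_
  · intro a ha b hb
    rw [mem_irr] at ha hb
    rw [Derivation.leibniz]
    simp [ha, hb]
  · intro a b ha hb
    simp [ha, hb]

theorem vars_min {r : ℕ} (v : Fin r → σ) (hv : Function.Injective v)
    (x : Fin r → MvPolynomial σ K) (hx : ∑ i, x i * X (v i) ∈ irr K σ ^ 2) (j : Fin r) :
    x j ∈ irr K σ := by
  classical
  have := pderiv_irr_sq hx (v j)
  rw [map_sum, map_sum, Finset.sum_eq_single j] at this
  · rw [mem_irr]
    simpa [Derivation.leibniz] using this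
  · intro i _ hij
    have : v i ≠ v j := fun h => hij (hv h)
    simp [Derivation.leibniz, pderiv_X_of_ne this]
  · simp

theorem var_mem_span {r : ℕ} (v : Fin r → σ) (hv : Function.Injective v) (j : Fin r)
    (c : MvPolynomial σ K) :
    c * X (v j) ∈ Ideal.span ((fun i => (X (v i) : MvPolynomial σ K)) '' {i | i < j}) ↔
      c ∈ Ideal.span ((fun i => (X (v i) : MvPolynomial σ K)) '' {i | i < j}) := by
  refine ⟨fun h => ?_, fun h => Ideal.mul_mem_right _ _ h⟩
  have himg : (fun i => (X (v i) : MvPolynomial σ K)) '' {i | i < j} = X '' (v '' {i | i < j}) := by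
    rw [Set.image_image]
  rw [himg] at h ⊢
  rw [mem_ideal_span_X_image] at h ⊢
  intro d hd
  obtain ⟨s, ⟨i, hi, rfl⟩, hs⟩ := h (d + Finsupp.single (v j) 1) (by
    rw [mem_support_iff, coeff_mul_X]; exact mem_support_iff.1 hd)
  refine ⟨v i, ⟨i, hi, rfl⟩, ?_⟩
  have hne : v j ≠ v i := fun h => (ne_of_lt hi) (hv h).symm
  simpa [Finsupp.single_apply, hne] using hs

theorem LinRes.vars (ℓ : ℕ) : ∀ (r : ℕ) (v : Fin r → σ) (_ : Function.Injective v),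
    LinRes (irr K σ) ℓ Unit
      (Submodule.comap (LinearMap.proj ())
        (Ideal.span (Set.range fun i => (X (v i) : MvPolynomial σ K))))
      (fun n => r.choose (n + 1)) := by
  induction ℓ with
  | zero => intros; trivial
  | succ ℓ ih =>
    intro r v hv
    let u : Fin r → MvPolynomial σ K := fun i => X (v i)
    let f : (Fin r → MvPolynomial σ K) →ₗ[MvPolynomial σ K] (Unit → MvPolynomial σ K) :=
      LinearMap.pi fun _ => Fintype.linearCombination _ u
    have hf : ∀ x, f x () = ∑ i, x i * X (v i) := by
      intro x
      simp [f, u, Fintype.linearCombination_apply]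
    have hmin : ∀ x, (∀ i, f x i ∈ irr K σ ^ 2) → ∀ k, x k ∈ irr K σ := by
      intro x hx k
      have := hx ()
      rw [hf] at this
      exact vars_min v hv x this k
    refine ⟨Fin r, inferInstance, f, by simp, ?_, hmin, ?_⟩
    · ext y
      rw [LinearMap.mem_range, Submodule.mem_comap, LinearMap.proj_apply,
        Ideal.mem_span_range_iff_exists_fun]
      constructor
      · rintro ⟨x, rfl⟩
        exact ⟨x, (hf x).symm⟩
      · rintro ⟨x, hx⟩
        exact ⟨x, funext fun _ => (hf x).trans hx⟩
    · have hk : LinearMap.ker f = LinearMap.ker (Fintype.linearCombination _ u) := by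
        ext x
        rw [LinearMap.mem_ker, LinearMap.mem_ker]
        exact ⟨fun h => congrFun h (), fun h => funext fun _ => h⟩
      have hb : (fun i => r.choose (i + 1 + 1)) = fun n => ∑ j : Fin r, (j : ℕ).choose (n + 1) := by
        ext n
        rw [Fin.sum_univ_eq_sum_range (fun j => j.choose (n + 1))]
        clear * -
        induction r with
        | zero => simp
        | succ r ih => rw [Finset.sum_range_succ, ← ih, Nat.choose_succ_succ, add_comm]
      rw [hk, hb]
      refine LinRes.syz (irr K σ) ℓ r u ?_
        (fun j => Submodule.comap (LinearMap.proj ()) (Ideal.span (u '' {i | i < j})))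
        (fun j n => (j : ℕ).choose (n + 1)) ?_ ?_
      · intro x hx
        exact vars_min v hv x (by
          have : ∑ i, x i * X (v i) = 0 := hx
          rw [this]; exact Ideal.zero_mem _)
      · intro j c
        exact (var_mem_span v hv j (c ())).symm
      · intro j
        have hj := ih j (fun i => v (Fin.castLE j.2.le i))
          (hv.comp (Fin.castLE_injective _))
        have : u '' {i | i < j} =
            Set.range fun i : Fin j => (X (v (Fin.castLE j.2.le i)) : MvPolynomial σ K) := by
          ext p
          constructor
          · rintro ⟨i, hi, rfl⟩
            exact ⟨⟨i.1, hi⟩, rfl⟩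
          · rintro ⟨i, rfl⟩
            exact ⟨_, i.2, rfl⟩
        rw [this]
        exact hj

theorem betti_main (k : ℕ) (u : Fin k → MvPolynomial σ K) (d : Fin k → σ →₀ ℕ)
    (hd : ∀ j, u j = monomial (d j) 1) (hdiv : ∀ i j, i ≠ j → ¬ u i ∣ u j)
    (S : Fin k → Finset σ)
    (hS : ∀ j c, c * u j ∈ Ideal.span (u '' {i | i < j}) ↔
      c ∈ Ideal.span ((fun s => (X s : MvPolynomial σ K)) '' (S j))) (ℓ : ℕ) :
    HasBetti (MvPolynomial σ K) ℓ (Ideal.span (Set.range u)) (∑ j, (S j).card.choose ℓ) := by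
  classical
  have hmin : ∀ x : Fin k → MvPolynomial σ K, ∑ i, x i * u i = 0 → ∀ i, x i ∈ irr K σ := by
    intro x hx j
    have h := congrArg (coeff (d j)) hx
    rw [coeff_sum, coeff_zero, Finset.sum_eq_single j] at h
    · rw [hd, coeff_mul_monomial'] at h
      rw [mem_irr, constantCoeff_eq]
      simpa using h
    · intro i _ hij
      rw [hd, coeff_mul_monomial', if_neg]
      intro hle
      apply hdiv i j hij
      rw [hd, hd]
      exact ⟨monomial (d j - d i) 1, by
        rw [monomial_mul, add_tsub_cancel_of_le hle, one_mul]⟩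
    · simp
  have hmem : ∀ x, Fintype.linearCombination (MvPolynomial σ K) u x ∈ Ideal.span (Set.range u) := by
    intro x
    rw [Ideal.mem_span_range_iff_exists_fun]
    exact ⟨x, by simp [Fintype.linearCombination_apply]⟩
  refine LinRes.hasBetti (irr K σ) irr_ne_top ℓ
    ((Fintype.linearCombination (MvPolynomial σ K) u).codRestrict _ hmem) ?_ ?_
    (fun ℓ => ∑ j, (S j).card.choose ℓ) (by simp) ?_
  · rintro ⟨y, hy⟩
    have hy' := hy
    rw [Ideal.mem_span_range_iff_exists_fun] at hy'
    obtain ⟨c, hc⟩ := hy'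
    refine ⟨c, Subtype.ext ?_⟩
    rw [LinearMap.codRestrict_apply, Fintype.linearCombination_apply]
    exact hc
  · intro x hx
    apply hmin
    have h := congrArg Subtype.val hx
    rw [LinearMap.codRestrict_apply, Fintype.linearCombination_apply] at h
    exact h
  · rw [LinearMap.ker_codRestrict]
    refine LinRes.syz (irr K σ) ℓ k u hmin
      (fun j => Submodule.comap (LinearMap.proj ())
        (Ideal.span ((fun s => (X s : MvPolynomial σ K)) '' (S j))))
      (fun j n => (S j).card.choose (n + 1)) (fun j c => (hS j (c ())).symm) ?_
    intro j
    have h := LinRes.vars (K := K) ℓ (S j).card (fun i => ((S j).equivFin.symm i : σ))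
      (Subtype.val_injective.comp (S j).equivFin.symm.injective)
    have : (fun s => (X s : MvPolynomial σ K)) '' (S j) =
        Set.range fun i => (X ((S j).equivFin.symm i : σ) : MvPolynomial σ K) := by
      ext p
      constructor
      · rintro ⟨s, hs, rfl⟩
        exact ⟨(S j).equivFin ⟨s, hs⟩, by simp⟩
      · rintro ⟨i, rfl⟩
        exact ⟨_, ((S j).equivFin.symm i).2, rfl⟩
    rw [this]
    exact h

end Poly

section Example
variable (K : Type) [Field K]

/-- The generators of the concrete example, in an order with linear quotients. -/
noncomputable def exGen : Fin 4 → PR K :=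
  ![xv K 0 * yv K 1 * zv K 2, xv K 0 * yv K 1 * zv K 3,
    xv K 2 * yv K 1 * zv K 3, xv K 2 * yv K 0 * zv K 3]

theorem exGen_dvd (i j : Fin 4) (hij : i ≠ j) : ¬ exGen K i ∣ exGen K j := by
  intro h
  have key : ∀ s : Fin 3 × Fin 4, (X s : PR K) ∣ exGen K i → (X s : PR K) ∣ exGen K j :=
    fun s hs => hs.trans h
  have k1 := key (2, 2)
  have k2 := key (2, 3)
  have k3 := key (0, 0)
  have k4 := key (0, 2)
  have k5 := key (1, 1)
  have k6 := key (1, 0)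
  fin_cases i <;> fin_cases j <;>
    simp [exGen, xv, yv, zv, X_dvd_mul_iff, X_dvd_X] at hij k1 k2 k3 k4 k5 k6

theorem exGen_colon (j : Fin 4) (c : PR K) :
    c * exGen K j ∈ Ideal.span (exGen K '' {i | i < j}) ↔
      c ∈ Ideal.span ((fun s => (X s : PR K)) ''
        ((![∅, {(2, 2)}, {(0, 0)}, {(1, 1)}] : Fin 4 → Finset (Fin 3 × Fin 4)) j)) := by
  have hlt : ∀ j : Fin 4, ∀ a, (∀ i < j, a ∣ exGen K i) →
      c * exGen K j ∈ Ideal.span (exGen K '' {i | i < j}) → a ∣ c * exGen K j := by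
    intro j a ha h
    rw [← Ideal.mem_span_singleton]
    refine (Ideal.span_le.2 ?_) h
    rintro _ ⟨i, hi, rfl⟩
    exact Ideal.mem_span_singleton.2 (ha i hi)
  have hin : ∀ (j i : Fin 4) (s : PR K), i < j → exGen K i ∣ s * exGen K j → s ∣ c →
      c * exGen K j ∈ Ideal.span (exGen K '' {i | i < j}) := by
    intro j i s hij hd ⟨t, ht⟩
    have h1 : exGen K i ∈ Ideal.span (exGen K '' {i | i < j}) :=
      Ideal.subset_span ⟨i, hij, rfl⟩
    refine Ideal.mem_of_dvd _ (hd.trans ⟨t, ?_⟩) h1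
    rw [ht]; ring
  have h4 : ∀ i : Fin 4, i < 2 → i = 0 ∨ i = 1 := by decide
  have h5 : ∀ i : Fin 4, i < 3 → i = 0 ∨ i = 1 ∨ i = 2 := by decide
  have h6 : ∀ i : Fin 4, i < 1 → i = 0 := by decide
  obtain rfl | rfl | rfl | rfl : j = 0 ∨ j = 1 ∨ j = 2 ∨ j = 3 := by
    revert j; decide
  · simp [exGen, xv, yv, zv]
  · have : c ∈ Ideal.span ((fun s => (X s : PR K)) ''
        ((![∅, {(2, 2)}, {(0, 0)}, {(1, 1)}] : Fin 4 → Finset (Fin 3 × Fin 4)) 1)) ↔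
        (X (2, 2) : PR K) ∣ c := by simp [Ideal.mem_span_singleton]
    rw [this]
    constructor
    · intro h
      have := hlt 1 (X (2, 2)) (by
        intro i hi
        obtain rfl := h6 i hi
        simp [exGen, xv, yv, zv, X_dvd_mul_iff]) h
      simpa [exGen, xv, yv, zv, X_dvd_mul_iff, X_dvd_X] using this
    · refine hin 1 0 (X (2, 2)) (by decide) ⟨X (2, 3), ?_⟩
      simp [exGen, xv, yv, zv]; ring
  · have : c ∈ Ideal.span ((fun s => (X s : PR K)) ''
        ((![∅, {(2, 2)}, {(0, 0)}, {(1, 1)}] : Fin 4 → Finset (Fin 3 × Fin 4)) 2)) ↔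
        (X (0, 0) : PR K) ∣ c := by simp [Ideal.mem_span_singleton]
    rw [this]
    constructor
    · intro h
      have := hlt 2 (X (0, 0)) (by
        intro i hi
        obtain rfl | rfl := h4 i hi <;> simp [exGen, xv, yv, zv, X_dvd_mul_iff]) h
      simpa [exGen, xv, yv, zv, X_dvd_mul_iff, X_dvd_X] using this
    · refine hin 2 1 (X (0, 0)) (by decide) ⟨X (0, 2), ?_⟩
      simp [exGen, xv, yv, zv]; ring
  · have : c ∈ Ideal.span ((fun s => (X s : PR K)) ''
        ((![∅, {(2, 2)}, {(0, 0)}, {(1, 1)}] : Fin 4 → Finset (Fin 3 × Fin 4)) 3)) ↔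
        (X (1, 1) : PR K) ∣ c := by simp [Ideal.mem_span_singleton]
    rw [this]
    constructor
    · intro h
      have := hlt 3 (X (1, 1)) (by
        intro i hi
        obtain rfl | rfl | rfl := h5 i hi <;> simp [exGen, xv, yv, zv, X_dvd_mul_iff]) h
      simpa [exGen, xv, yv, zv, X_dvd_mul_iff, X_dvd_X] using this
    · refine hin 3 2 (X (1, 1)) (by decide) ⟨X (1, 0), ?_⟩
      simp [exGen, xv, yv, zv]; ring

theorem exGen_betti (ℓ : ℕ) :
    HasBetti (PR K) ℓ
        (Ideal.span {m | m ∈ [xv K 0 * yv K 1 * zv K 2, xv K 0 * yv K 1 * zv K 3,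
          xv K 2 * yv K 0 * zv K 3, xv K 2 * yv K 1 * zv K 3]})
      (Nat.choose 0 ℓ + Nat.choose 1 ℓ + Nat.choose 1 ℓ + Nat.choose 1 ℓ) := by
  have hset : {m | m ∈ [xv K 0 * yv K 1 * zv K 2, xv K 0 * yv K 1 * zv K 3,
          xv K 2 * yv K 0 * zv K 3, xv K 2 * yv K 1 * zv K 3]} = Set.range (exGen K) := by
    ext p
    simp [exGen, Fin.exists_fin_succ, eq_comm]
    tauto
  rw [hset]
  have hd : ∀ j, ∃ d : Fin 3 × Fin 4 →₀ ℕ, exGen K j = monomial d 1 := by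
    have h3 : ∀ a b c : Fin 3 × Fin 4, ∃ d : Fin 3 × Fin 4 →₀ ℕ,
        (X a * X b * X c : PR K) = monomial d 1 :=
      fun a b c => ⟨Finsupp.single a 1 + Finsupp.single b 1 + Finsupp.single c 1,
        by simp only [X, monomial_mul, one_mul]⟩
    intro j
    obtain rfl | rfl | rfl | rfl : j = 0 ∨ j = 1 ∨ j = 2 ∨ j = 3 := by
      revert j; decide
    all_goals exact h3 _ _ _
  choose d hd using hd
  have h := betti_main 4 (exGen K) d hd (exGen_dvd K) _ (exGen_colon K) ℓ
  simpa [Fin.sum_univ_four] using h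

end Example

/-- Herzog–Takayama: if the monomial ideal `I = (m_1,…,m_k)` (minimal monomial
generators: duplicate-free, none dividing another) has linear quotients with respect to
this order, with `set(m_j)` the set of variables generating the colon ideal
`(m_1,…,m_{j-1}) : m_j`, then for each `ℓ ≥ 1` the `ℓ`-th Betti number of `I` equals
`∑_j binomial(|set(m_j)|, ℓ-1)` — here `β_ℓ` is the rank of the `ℓ`-th free module `F_ℓ`
in the minimal free resolution `… → F_2 → F_1 → I → 0`, i.e. `HasBetti` at step `ℓ - 1`.
In particular, for `I = (x_1 y_2 z_3, x_1 y_2 z_4, x_3 y_1 z_4, x_3 y_2 z_4)` (with the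
usual indexing of Betti numbers starting at `β_0 = #generators`) one has `β_0(I) = 4`
and `β_1(I) = 3`. -/
theorem stmt_2 (K : Type) [Field K] (N : ℕ)
    (L : List (MvPolynomial (Fin N) K))
    (hmon : ∀ u ∈ L, ∃ d : Fin N →₀ ℕ, u = monomial d 1)
    (hnd : L.Nodup)
    (hmin : ∀ u ∈ L, ∀ u' ∈ L, u ≠ u' → ¬ u ∣ u')
    (St : Fin L.length → Finset (Fin N))
    (hSt : ∀ j : Fin L.length,
      (Ideal.span {m | m ∈ L.take j.val}).colon (Ideal.span {L.get j}) =
        Ideal.span ((fun s => (X s : MvPolynomial (Fin N) K)) '' (St j))) :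
    (∀ ℓ : ℕ, 1 ≤ ℓ →
      HasBetti (MvPolynomial (Fin N) K) (ℓ - 1) (Ideal.span {u | u ∈ L})
        (∑ j : Fin L.length, ((St j).card.choose (ℓ - 1)))) ∧
    (HasBetti (PR K) 0
        (Ideal.span {m | m ∈ [xv K 0 * yv K 1 * zv K 2, xv K 0 * yv K 1 * zv K 3,
          xv K 2 * yv K 0 * zv K 3, xv K 2 * yv K 1 * zv K 3]}) 4 ∧
      HasBetti (PR K) 1
        (Ideal.span {m | m ∈ [xv K 0 * yv K 1 * zv K 2, xv K 0 * yv K 1 * zv K 3,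
          xv K 2 * yv K 0 * zv K 3, xv K 2 * yv K 1 * zv K 3]}) 3) := by
  refine ⟨?_, exGen_betti K 0, exGen_betti K 1⟩
  intro ℓ _
  have hrange : {u | u ∈ L} = Set.range L.get := by
    ext p
    exact List.mem_iff_get
  rw [hrange]
  choose d hd using fun j : Fin L.length => hmon _ (List.get_mem L j)
  refine betti_main L.length L.get d hd ?_ St ?_ (ℓ - 1)
  · intro i j hij
    exact hmin _ (List.get_mem L i) _ (List.get_mem L j)
      (fun h => hij (List.nodup_iff_injective_get.1 hnd h))
  · intro j c
    have himg : {m | m ∈ L.take j.val} = L.get '' {i | i < j} := by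
      ext p
      rw [Set.mem_ofPred_eq, List.mem_take_iff_getElem]
      constructor
      · rintro ⟨i, hi, rfl⟩
        exact ⟨⟨i, by omega⟩, (lt_min_iff.1 hi).1, rfl⟩
      · rintro ⟨i, hi, rfl⟩
        exact ⟨i.1, lt_min hi i.2, rfl⟩
    rw [← hSt j, himg, Ideal.mem_colon_span_singleton]
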